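/- Let μ ∈ ℝ^d, let Ω be a symmetric positive-definite d×d matrix with ω = diag(Ω)^{1/2} and Ω̄ = ω⁻¹Ωω⁻¹, and let α ∈ ℝ^d, τ, κ ∈ ℝ, ν > 0. Set δ = (1 + αᵀΩ̄α)^{−1/2} Ω̄α, κ̄ = (1 + αᵀΩ̄α)^{−1/2} κ, τ̄ = (1 + αᵀΩ̄α)^{−1/2} τ, and let Ω* be the (d+1)×(d+1) matrix with blocks Ω̄, −δ, −δᵀ, 1. Then Ω* is symmetric positive definite and, for every y ∈ ℝ^d, with z = ω⁻¹(y − μ), ∫_{∏_{j=1}^d (−∞, y_j]} ψ_d(u; μ, Ω, α, τ, κ, ν) du = Ψ_{d+1}( (zᵀ, τ̄)ᵀ; Ω*, (0, …, 0, κ̄)ᵀ, ν ) / Ψ(τ̄; κ̄, ν); that is, the distribution function of the non-central extended skew-t distribution equals the stated ratio of a (d+1)-dimensional non-central t distribution function and a univariate non-central t distribution function. -/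

import Mathlib

open MeasureTheory Real Filter Matrix Set Topology Asymptotics

noncomputable section

/-- Standard normal density. -/
def nPdf (x : ℝ) : ℝ := (Real.sqrt (2 * π))⁻¹ * Real.exp (-(x ^ 2) / 2)

/-- Standard normal distribution function. -/
def nCdf (x : ℝ) : ℝ := ∫ u in Set.Iio x, nPdf u

/-- Centred multivariate normal density with covariance matrix `S`. -/
def mvnPdf {ι : Type*} [Fintype ι] [DecidableEq ι] (S : Matrix ι ι ℝ) (y : ι → ℝ) : ℝ :=
  (2 * π) ^ (-(Fintype.card ι : ℝ) / 2) * S.det ^ (-(1 : ℝ) / 2) *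
    Real.exp (-(y ⬝ᵥ S⁻¹.mulVec y) / 2)

/-- Centred multivariate normal distribution function. -/
def mvnCdf {ι : Type*} [Fintype ι] [DecidableEq ι] (S : Matrix ι ι ℝ) (w : ι → ℝ) : ℝ :=
  ∫ u in Set.univ.pi fun i => Set.Iic (w i), mvnPdf S u

/-- Multivariate central Student-t density with scale matrix `S` and `ν` degrees of freedom. -/
def tPdf {ι : Type*} [Fintype ι] [DecidableEq ι] (S : Matrix ι ι ℝ) (ν : ℝ) (y : ι → ℝ) : ℝ :=
  Real.Gamma ((ν + Fintype.card ι) / 2) *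
      (1 + y ⬝ᵥ S⁻¹.mulVec y / ν) ^ (-(ν + Fintype.card ι) / 2) /
    (Real.Gamma (ν / 2) * (ν * π) ^ ((Fintype.card ι : ℝ) / 2) * Real.sqrt S.det)

/-- Univariate non-central t distribution function with non-centrality `a`. -/
def nctCdf (x a ν : ℝ) : ℝ :=
  ∫ v in Set.Ioi (0 : ℝ),
    v ^ (ν / 2 - 1) * Real.exp (-v) / Real.Gamma (ν / 2) *
      nCdf (x * Real.sqrt (2 * v / ν) - a)

/-- Multivariate non-central t distribution function. -/
def mvnctCdf {ι : Type*} [Fintype ι] [DecidableEq ι]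
    (y : ι → ℝ) (S : Matrix ι ι ℝ) (κ : ι → ℝ) (ν : ℝ) : ℝ :=
  ∫ v in Set.Ioi (0 : ℝ),
    v ^ (ν / 2 - 1) * Real.exp (-v) / Real.Gamma (ν / 2) *
      mvnCdf S fun i => y i * Real.sqrt (2 * v / ν) - κ i

/-- Multivariate non-central t density (scale-mixture form). -/
def mvnctPdf {ι : Type*} [Fintype ι] [DecidableEq ι]
    (μ : ι → ℝ) (S : Matrix ι ι ℝ) (κ : ι → ℝ) (ν : ℝ) (y : ι → ℝ) : ℝ :=
  ∫ v in Set.Ioi (0 : ℝ),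
    v ^ (ν / 2 - 1) * Real.exp (-v) / Real.Gamma (ν / 2) *
      ((2 * v / ν) ^ ((Fintype.card ι : ℝ) / 2) *
        mvnPdf S fun i => Real.sqrt (2 * v / ν) * (y i - μ i) - κ i)

/-- Univariate non-central t density with location `μ`, scale (standard deviation) `s`,
non-centrality `κ` and `ν` degrees of freedom. -/
def nctPdf1 (μ s κ ν x : ℝ) : ℝ :=
  ∫ v in Set.Ioi (0 : ℝ),
    v ^ (ν / 2 - 1) * Real.exp (-v) / Real.Gamma (ν / 2) *
      (Real.sqrt (2 * v / ν) * s⁻¹ * nPdf (Real.sqrt (2 * v / ν) * (x - μ) / s - κ))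

/-- Non-central extended skew-t density. -/
def skewTPdf {ι : Type*} [Fintype ι] [DecidableEq ι]
    (μ : ι → ℝ) (Ω : Matrix ι ι ℝ) (α : ι → ℝ) (τ κ ν : ℝ) (y : ι → ℝ) : ℝ :=
  let d : ℝ := Fintype.card ι
  let ω : Matrix ι ι ℝ := Matrix.diagonal fun i => Real.sqrt (Ω i i)
  let Ωb : Matrix ι ι ℝ := ω⁻¹ * Ω * ω⁻¹
  let z : ι → ℝ := ω⁻¹.mulVec fun i => y i - μ i
  let Q : ℝ := α ⬝ᵥ Ωb.mulVec α
  tPdf Ω ν (fun i => y i - μ i) *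
      nctCdf ((α ⬝ᵥ z + τ) * Real.sqrt ((ν + d) / (ν + z ⬝ᵥ Ωb⁻¹.mulVec z))) κ (ν + d) /
    nctCdf (τ / Real.sqrt (1 + Q)) (κ / Real.sqrt (1 + Q)) ν

/-- Non-central extended skew-t distribution function. -/
def skewTCdf {ι : Type*} [Fintype ι] [DecidableEq ι]
    (μ : ι → ℝ) (Ω : Matrix ι ι ℝ) (α : ι → ℝ) (τ κ ν : ℝ) (y : ι → ℝ) : ℝ :=
  ∫ u in Set.univ.pi fun i => Set.Iic (y i), skewTPdf μ Ω α τ κ ν u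

lemma nPdf_eq_gauss : nPdf = ProbabilityTheory.gaussianPDFReal 0 1 := by
  funext x
  simp [nPdf, ProbabilityTheory.gaussianPDFReal]

lemma nPdf_integrable : Integrable nPdf := by
  rw [nPdf_eq_gauss]; exact ProbabilityTheory.integrable_gaussianPDFReal 0 1

lemma nPdf_nonneg (x : ℝ) : 0 ≤ nPdf x := by unfold nPdf; positivity

lemma nCdf_nonneg (x : ℝ) : 0 ≤ nCdf x := by
  unfold nCdf; exact integral_nonneg fun u => nPdf_nonneg u

lemma nCdf_le_one (x : ℝ) : nCdf x ≤ 1 := by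
  have h : ∫ u, nPdf u = 1 := by
    rw [nPdf_eq_gauss]; exact ProbabilityTheory.integral_gaussianPDFReal_eq_one 0 one_ne_zero
  rw [← h]
  exact setIntegral_le_integral nPdf_integrable (ae_of_all _ nPdf_nonneg)

lemma nCdf_mono : Monotone nCdf := by
  intro x y hxy
  exact setIntegral_mono_set nPdf_integrable.integrableOn (ae_of_all _ nPdf_nonneg)
    (LE.le.eventuallyLE (Set.Iio_subset_Iio hxy))

lemma nCdf_meas : Measurable nCdf := nCdf_mono.measurable

lemma swap_aux {X Y : Type*} [MeasurableSpace X] [MeasurableSpace Y] (m : Measure X)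
    (n : Measure Y) [SFinite m] [SFinite n] (f : X → Y → ℝ)
    (hf : Measurable (Function.uncurry f))
    (h0 : ∀ᵐ y ∂n, ∀ x, 0 ≤ f x y)
    (h1 : ∀ᵐ x ∂m, Integrable (f x) n) (h2 : ∀ᵐ y ∂n, Integrable (fun x => f x y) m) :
    ∫ x, ∫ y, f x y ∂n ∂m = ∫ y, ∫ x, f x y ∂m ∂n := by
  have hx0 : ∀ x, ∀ᵐ y ∂n, 0 ≤ f x y := fun x => h0.mono fun y hy => hy x
  rw [integral_eq_lintegral_of_nonneg_ae (ae_of_all _ fun x => integral_nonneg_of_ae (hx0 x)),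
    integral_eq_lintegral_of_nonneg_ae]
  · congr 1
    have e1 : ∫⁻ x, ENNReal.ofReal (∫ y, f x y ∂n) ∂m = ∫⁻ x, ∫⁻ y, ENNReal.ofReal (f x y) ∂n ∂m := by
      apply lintegral_congr_ae
      filter_upwards [h1] with x hx
      exact ofReal_integral_eq_lintegral_ofReal hx (hx0 x)
    have e2 : ∫⁻ y, ENNReal.ofReal (∫ x, f x y ∂m) ∂n = ∫⁻ y, ∫⁻ x, ENNReal.ofReal (f x y) ∂m ∂n := by
      apply lintegral_congr_ae
      filter_upwards [h2, h0] with y hy hy0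
      exact ofReal_integral_eq_lintegral_ofReal hy (ae_of_all _ hy0)
    rw [e1, e2, lintegral_lintegral_swap]
    exact hf.ennreal_ofReal.aemeasurable
  · filter_upwards [h0] with y hy using integral_nonneg hy
  · exact (hf.comp measurable_swap).stronglyMeasurable.integral_prod_right'.aestronglyMeasurable
  · exact hf.stronglyMeasurable.integral_prod_right'.aestronglyMeasurable

lemma coercive_aux {ι : Type*} [Fintype ι] [DecidableEq ι] (A : Matrix ι ι ℝ) (hA : A.PosDef) :
    ∃ c > 0, ∀ x : ι → ℝ, c * ∑ i, x i ^ 2 ≤ x ⬝ᵥ A.mulVec x := by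
  have hc : Continuous fun x : ι → ℝ => x ⬝ᵥ A.mulVec x := by fun_prop
  obtain ⟨c, hc0, hcs⟩ := (isCompact_sphere (0 : ι → ℝ) 1).exists_forall_le' (a := 0)
    hc.continuousOn (by
      intro x hx
      have hx0 : x ≠ 0 := by
        rintro rfl
        simp at hx
      simpa using hA.dotProduct_mulVec_pos hx0)
  have hk : ∀ x : ι → ℝ, c * ‖x‖ ^ 2 ≤ x ⬝ᵥ A.mulVec x := by
    intro x
    rcases eq_or_ne x 0 with rfl | hx
    · simp
    have hn : 0 < ‖x‖ := norm_pos_iff.mpr hx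
    have h := hcs (‖x‖⁻¹ • x) (by simp [norm_smul, hn.ne'])
    rw [Matrix.mulVec_smul, smul_dotProduct, dotProduct_smul, smul_eq_mul, smul_eq_mul,
      ← mul_assoc, ← mul_inv, ← sq, inv_mul_eq_div, le_div_iff₀ (by positivity)] at h
    exact h
  refine ⟨c / (Fintype.card ι + 1), by positivity, fun x => le_trans ?_ (hk x)⟩
  have hs : ∑ i, x i ^ 2 ≤ (Fintype.card ι + 1) * ‖x‖ ^ 2 := by
    have : ∑ i, x i ^ 2 ≤ ∑ _i : ι, ‖x‖ ^ 2 := Finset.sum_le_sum fun i _ => by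
      rw [← sq_abs]
      have := norm_le_pi_norm x i
      rw [Real.norm_eq_abs] at this
      gcongr
    simp at this
    nlinarith [sq_nonneg ‖x‖]
  calc c / (Fintype.card ι + 1) * ∑ i, x i ^ 2
      ≤ c / (Fintype.card ι + 1) * ((Fintype.card ι + 1) * ‖x‖ ^ 2) := by gcongr
    _ = c * ‖x‖ ^ 2 := by field_simp

lemma mvnPdf_cont {ι : Type*} [Fintype ι] [DecidableEq ι] (S : Matrix ι ι ℝ) :
    Continuous (mvnPdf S) := by
  unfold mvnPdf; fun_prop

lemma mvnPdf_nonneg {ι : Type*} [Fintype ι] [DecidableEq ι] (S : Matrix ι ι ℝ) (hS : S.PosDef) (x) :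
    0 ≤ mvnPdf S x := by
  have := hS.det_pos
  unfold mvnPdf; positivity

lemma mvnPdf_integrable {ι : Type*} [Fintype ι] [DecidableEq ι] (S : Matrix ι ι ℝ) (hS : S.PosDef) :
    Integrable (mvnPdf S) := by
  obtain ⟨c, hc, h⟩ := coercive_aux S⁻¹ hS.inv
  unfold mvnPdf
  apply Integrable.const_mul
  have hg : Integrable (fun x : ι → ℝ => ∏ i, Real.exp (-(c/2) * x i ^ 2)) :=
    Integrable.fintype_prod (f := fun _ (t : ℝ) => Real.exp (-(c/2) * t ^ 2))
      fun i => integrable_exp_neg_mul_sq (by positivity)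
  refine hg.mono' (by fun_prop) (ae_of_all _ fun x => ?_)
  rw [Real.norm_eq_abs, Real.abs_exp, ← Real.exp_sum, ← Finset.mul_sum]
  apply Real.exp_le_exp.mpr
  linarith [h x]

lemma cov_aux {ι : Type*} [Fintype ι] [DecidableEq ι] (M : Matrix ι ι ℝ) (hM : M.det ≠ 0)
    (μ : ι → ℝ) (h : (ι → ℝ) → ℝ) :
    ∫ u : ι → ℝ, h (M.mulVec fun i => u i - μ i) = |M.det|⁻¹ * ∫ u, h u := by
  have h1 : ∫ u : ι → ℝ, h (M.mulVec fun i => u i - μ i) = ∫ u : ι → ℝ, h (M.mulVec u) :=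
    integral_sub_right_eq_self (fun u => h (M.mulVec u)) μ
  have hemb : MeasurableEmbedding (Matrix.toLin' M) := by
    have hu : IsUnit M.det := hM.isUnit
    let e := (Matrix.toLinearEquiv' M ((Matrix.isUnit_iff_isUnit_det M).2 hu |>.invertible)).toContinuousLinearEquiv
    exact e.toHomeomorph.measurableEmbedding
  rw [h1]
  have := hemb.integral_map (μ := volume) h
  rw [Real.map_matrix_volume_pi_eq_smul_volume_pi hM, integral_smul_measure,
    ENNReal.toReal_ofReal (abs_nonneg _)] at this
  simp only [Matrix.toLin'_apply] at this
  rw [← this, abs_inv, smul_eq_mul]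

lemma quad_nonneg {ι : Type*} [Fintype ι] [DecidableEq ι] (S : Matrix ι ι ℝ) (hS : S.PosDef)
    (x : ι → ℝ) : 0 ≤ x ⬝ᵥ S⁻¹.mulVec x := by
  simpa using hS.inv.posSemidef.dotProduct_mulVec_nonneg x

lemma quad_smul {ι : Type*} [Fintype ι] [DecidableEq ι] (S : Matrix ι ι ℝ) (s : ℝ)
    (x : ι → ℝ) : (fun i => s * x i) ⬝ᵥ S⁻¹.mulVec (fun i => s * x i)
      = s ^ 2 * (x ⬝ᵥ S⁻¹.mulVec x) := by
  have : (fun i => s * x i) = s • x := by ext i; simp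
  rw [this, Matrix.mulVec_smul, smul_dotProduct, dotProduct_smul, smul_eq_mul, smul_eq_mul]
  ring

lemma sqrt_pow_aux (n : ℕ) (a : ℝ) (ha : 0 ≤ a) : Real.sqrt a ^ n = a ^ ((n : ℝ) / 2) := by
  rw [Real.sqrt_eq_rpow, ← Real.rpow_natCast, ← Real.rpow_mul ha]
  congr 1; ring

lemma point_aux {ι : Type*} [Fintype ι] [DecidableEq ι] (S : Matrix ι ι ℝ) (hS : S.PosDef)
    (x : ι → ℝ) (c κ ν : ℝ) (hν : 0 < ν) :
    tPdf S ν x * nctCdf (c * Real.sqrt ((ν + Fintype.card ι) / (ν + x ⬝ᵥ S⁻¹.mulVec x))) κ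
        (ν + Fintype.card ι) =
      ∫ v in Set.Ioi (0 : ℝ), v ^ (ν / 2 - 1) * Real.exp (-v) / Real.Gamma (ν / 2) *
        (Real.sqrt (2 * v / ν) ^ Fintype.card ι * mvnPdf S (fun i => Real.sqrt (2 * v / ν) * x i) *
          nCdf (c * Real.sqrt (2 * v / ν) - κ)) := by
  have hq := quad_nonneg S hS x
  have hdet := hS.det_pos
  set q := x ⬝ᵥ S⁻¹.mulVec x with hqdef
  set n := Fintype.card ι with hn
  have hb : 0 < 1 + q / ν := by positivity
  set b := 1 + q / ν with hbdef
  have hG : 0 < Real.Gamma ((ν + n) / 2) := Real.Gamma_pos_of_pos (by positivity)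
  have hG2 : 0 < Real.Gamma (ν / 2) := Real.Gamma_pos_of_pos (by positivity)
  unfold nctCdf
  have hcv := integral_comp_mul_left_Ioi (fun v => v ^ ((ν + n) / 2 - 1) * Real.exp (-v) /
    Real.Gamma ((ν + n) / 2) * nCdf (c * Real.sqrt ((ν + n) / (ν + q)) *
      Real.sqrt (2 * v / (ν + n)) - κ)) 0 hb
  rw [mul_zero, smul_eq_mul, eq_inv_mul_iff_mul_eq₀ hb.ne'] at hcv
  rw [← hcv, ← integral_const_mul, ← integral_const_mul]
  apply setIntegral_congr_fun measurableSet_Ioi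
  intro v hv
  have hv : 0 < v := hv
  have e1 : c * Real.sqrt ((ν + n) / (ν + q)) * Real.sqrt (2 * (b * v) / (ν + n)) =
      c * Real.sqrt (2 * v / ν) := by
    rw [mul_assoc, ← Real.sqrt_mul (by positivity)]
    congr 2
    rw [hbdef]; field_simp
  simp only [e1, mvnPdf, tPdf, quad_smul, ← hqdef, ← hn]
  rw [Real.sq_sqrt (by positivity), sqrt_pow_aux _ _ (by positivity)]
  have e2 : Real.exp (-(b * v)) = Real.exp (-v) * Real.exp (-(2 * v / ν * q) / 2) := by
    rw [← Real.exp_add]; congr 1; rw [hbdef]; field_simp; ring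
  have e3 : b ^ (-(ν + n) / 2) * b * b ^ ((ν + n) / 2 - 1) = 1 := by
    nth_rewrite 2 [← Real.rpow_one b]
    rw [← Real.rpow_add hb, ← Real.rpow_add hb]
    convert Real.rpow_zero b using 2; ring
  have e4 : v ^ ((ν + n) / 2 - 1) = v ^ (ν / 2 - 1) * v ^ ((n : ℝ) / 2) := by
    rw [← Real.rpow_add hv]; congr 1; ring
  have e5 : S.det ^ (-(1 : ℝ) / 2) = (Real.sqrt S.det)⁻¹ := by
    rw [Real.sqrt_eq_rpow, ← Real.rpow_neg hdet.le]; congr 1; ring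
  have e6 : (2 * π) ^ (-(n : ℝ) / 2) = (2 ^ ((n : ℝ) / 2))⁻¹ * (π ^ ((n : ℝ) / 2))⁻¹ := by
    rw [neg_div, Real.rpow_neg (by positivity), Real.mul_rpow (by positivity) (by positivity),
      mul_inv]
  have e7 : (2 * v / ν) ^ ((n : ℝ) / 2) = 2 ^ ((n : ℝ) / 2) * v ^ ((n : ℝ) / 2) /
      ν ^ ((n : ℝ) / 2) := by
    rw [Real.div_rpow (by positivity) (by positivity),
      Real.mul_rpow (by positivity) (by positivity)]
  have e8 : (ν * π) ^ ((n : ℝ) / 2) = ν ^ ((n : ℝ) / 2) * π ^ ((n : ℝ) / 2) :=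
    Real.mul_rpow (by positivity) (by positivity)
  rw [e2, Real.mul_rpow hb.le hv.le, e4, e5, e6, e7, e8]
  have h1 : (0 : ℝ) < 2 ^ ((n : ℝ) / 2) := by positivity
  have h2 : (0 : ℝ) < ν ^ ((n : ℝ) / 2) := by positivity
  have h3 : (0 : ℝ) < π ^ ((n : ℝ) / 2) := by positivity
  have h4 : 0 < Real.sqrt S.det := by positivity
  generalize (2 : ℝ) ^ ((n : ℝ) / 2) = A at *
  generalize ν ^ ((n : ℝ) / 2) = B at *
  generalize π ^ ((n : ℝ) / 2) = C at *
  generalize Real.sqrt S.det = D at *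
  generalize Real.Gamma ((ν + n) / 2) = G at *
  generalize Real.Gamma (ν / 2) = G2 at *
  generalize nCdf (c * Real.sqrt (2 * v / ν) - κ) = N at *
  generalize Real.exp (-(2 * v / ν * q) / 2) = E1 at *
  generalize Real.exp (-v) = E2 at *
  generalize v ^ (ν / 2 - 1) = V1 at *
  generalize v ^ ((n : ℝ) / 2) = V2 at *
  generalize b ^ (-(ν + n) / 2) = B1 at *
  generalize b ^ ((ν + n) / 2 - 1) = B2 at *
  clear_value b
  calc _ = (B1 * b * B2) * (V1 * V2 * E1 * E2 * N / (G2 * (B * C) * D)) := by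
        field_simp
    _ = _ := by rw [e3]; field_simp

lemma int_v_aux {ι : Type*} [Fintype ι] [DecidableEq ι] (S : Matrix ι ι ℝ) (hS : S.PosDef)
    (x : ι → ℝ) (c κ ν : ℝ) (hν : 0 < ν) :
    IntegrableOn (fun v => v ^ (ν / 2 - 1) * Real.exp (-v) / Real.Gamma (ν / 2) *
        (Real.sqrt (2 * v / ν) ^ Fintype.card ι * mvnPdf S (fun i => Real.sqrt (2 * v / ν) * x i) *
          nCdf (c * Real.sqrt (2 * v / ν) - κ))) (Set.Ioi (0 : ℝ)) := by
  set n := Fintype.card ι with hn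
  have hdet := hS.det_pos
  have hG2 : 0 < Real.Gamma (ν / 2) := Real.Gamma_pos_of_pos (by positivity)
  set K := (2 * π) ^ (-(n : ℝ) / 2) * S.det ^ (-(1 : ℝ) / 2) with hK
  have hK0 : 0 ≤ K := by positivity
  have hle : ∀ w, mvnPdf S w ≤ K := fun w => by
    unfold mvnPdf
    have : Real.exp (-(w ⬝ᵥ S⁻¹.mulVec w) / 2) ≤ 1 :=
      Real.exp_le_one_iff.mpr (by linarith [quad_nonneg S hS w])
    rw [← hn, ← hK]; nlinarith
  have hg := (Real.GammaIntegral_convergent (s := (ν + n) / 2) (by positivity)).const_mul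
    ((Real.Gamma (ν / 2))⁻¹ * (2 / ν) ^ ((n : ℝ) / 2) * K)
  refine Integrable.mono' hg ?_ ?_
  · have := (mvnPdf_cont S).measurable
    have := nCdf_meas
    apply Measurable.aestronglyMeasurable
    fun_prop
  · filter_upwards [ae_restrict_mem measurableSet_Ioi] with v hv
    have hv : 0 < v := hv
    have hp := mvnPdf_nonneg S hS (fun i => Real.sqrt (2 * v / ν) * x i)
    have hp2 := hle (fun i => Real.sqrt (2 * v / ν) * x i)
    have hc0 := nCdf_nonneg (c * Real.sqrt (2 * v / ν) - κ)
    have hc1 := nCdf_le_one (c * Real.sqrt (2 * v / ν) - κ)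
    rw [Real.norm_of_nonneg (by positivity), sqrt_pow_aux _ _ (by positivity)]
    have e4 : v ^ ((ν + n) / 2 - 1) = v ^ (ν / 2 - 1) * v ^ ((n : ℝ) / 2) := by
      rw [← Real.rpow_add hv]; congr 1; ring
    have e7 : (2 * v / ν) ^ ((n : ℝ) / 2) = (2 / ν) ^ ((n : ℝ) / 2) * v ^ ((n : ℝ) / 2) := by
      rw [← Real.mul_rpow (by positivity) (by positivity)]; congr 1; ring
    rw [e4, e7]
    calc _ ≤ v ^ (ν / 2 - 1) * Real.exp (-v) / Real.Gamma (ν / 2) *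
        ((2 / ν) ^ ((n : ℝ) / 2) * v ^ ((n : ℝ) / 2) * K * 1) := by gcongr
      _ = _ := by ring


lemma symm_aux {ι : Type*} [Fintype ι] [DecidableEq ι] (B : Matrix ι ι ℝ) (hB : B.PosDef)
    (x y : ι → ℝ) : x ⬝ᵥ B.mulVec y = y ⬝ᵥ B.mulVec x := by
  have hT : Bᵀ = B := by simpa [Matrix.IsHermitian] using hB.isHermitian
  rw [Matrix.dotProduct_mulVec, dotProduct_comm, ← Matrix.mulVec_transpose, hT]

/-- Auxiliary block matrix. -/
def starM {ι : Type*} (B : Matrix ι ι ℝ) (δ : ι → ℝ) : Matrix (ι ⊕ Unit) (ι ⊕ Unit) ℝ :=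
  Matrix.fromBlocks B (Matrix.of fun a _ => -δ a) (Matrix.of fun _ b => -δ b) 1

lemma starM_mulVec {ι : Type*} [Fintype ι] [DecidableEq ι] (B : Matrix ι ι ℝ) (δ a : ι → ℝ)
    (b : Unit → ℝ) :
    (starM B δ).mulVec (Sum.elim a b) =
      Sum.elim (B.mulVec a - b () • δ) (fun _ => - (δ ⬝ᵥ a) + b ()) := by
  unfold starM
  rw [Matrix.fromBlocks_mulVec]
  ext i
  rcases i with i | i
  · simp [Matrix.mulVec, dotProduct]; ring
  · simp [Matrix.mulVec, dotProduct]

lemma starM_posDef {ι : Type*} [Fintype ι] [DecidableEq ι] (B : Matrix ι ι ℝ) (hB : B.PosDef)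
    (α : ι → ℝ) (r : ℝ) (hr : 0 < r) (hrQ : r ^ 2 = 1 + α ⬝ᵥ B.mulVec α) :
    (starM B (fun i => B.mulVec α i / r)).PosDef := by
  apply Matrix.PosDef.of_dotProduct_mulVec_pos
  · unfold starM
    apply Matrix.IsHermitian.fromBlocks hB.isHermitian
    · ext i j; simp
    · simp
  · intro x hx
    obtain ⟨a, b, rfl⟩ : ∃ a b, x = Sum.elim a b :=
      ⟨fun i => x (Sum.inl i), fun i => x (Sum.inr i), by ext i; rcases i <;> rfl⟩
    have hδ : (fun i => B.mulVec α i / r) = r⁻¹ • B.mulVec α := by ext i; simp; ring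
    rw [star_trivial, starM_mulVec, hδ]
    have key : Sum.elim a b ⬝ᵥ Sum.elim (B.mulVec a - b () • r⁻¹ • B.mulVec α)
        (fun _ => - ((r⁻¹ • B.mulVec α) ⬝ᵥ a) + b ()) =
        (a - (b () / r) • α) ⬝ᵥ B.mulVec (a - (b () / r) • α) + (b () / r) ^ 2 := by
      rw [sumElim_dotProduct_sumElim]
      have : b ⬝ᵥ (fun _ => - ((r⁻¹ • B.mulVec α) ⬝ᵥ a) + b ()) =
          b () * (- ((r⁻¹ • B.mulVec α) ⬝ᵥ a) + b ()) := by simp [dotProduct]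
      rw [this]
      simp only [Matrix.mulVec_sub, Matrix.mulVec_smul, dotProduct_sub, sub_dotProduct,
        smul_dotProduct, dotProduct_smul, smul_eq_mul]
      rw [dotProduct_comm (B.mulVec α) a, symm_aux B hB α a]
      have hQ : α ⬝ᵥ B.mulVec α = r ^ 2 - 1 := by linarith
      rw [hQ]
      field_simp
      ring
    rw [key]
    have h0 : 0 ≤ (a - (b () / r) • α) ⬝ᵥ B.mulVec (a - (b () / r) • α) := by
      simpa using hB.posSemidef.dotProduct_mulVec_nonneg (a - (b () / r) • α)
    by_cases hb : b () = 0
    · have ha : a ≠ 0 := by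
        rintro rfl
        apply hx
        ext i; rcases i with i | i
        · rfl
        · exact hb
      have := hB.dotProduct_mulVec_pos ha
      simpa [hb] using this
    · have : 0 < (b () / r) ^ 2 := by positivity
      linarith

lemma starM_det {ι : Type*} [Fintype ι] [DecidableEq ι] (B : Matrix ι ι ℝ) (hB : B.PosDef)
    (α : ι → ℝ) (r : ℝ) (hr : 0 < r) (hrQ : r ^ 2 = 1 + α ⬝ᵥ B.mulVec α) :
    (starM B (fun i => B.mulVec α i / r)).det = B.det * (r ^ 2)⁻¹ := by
  have hdet := hB.det_pos
  let _ : Invertible B := hB.isUnit.invertible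
  unfold starM
  rw [Matrix.det_fromBlocks₁₁]
  congr 1
  have hδ : (fun i => B.mulVec α i / r) = r⁻¹ • B.mulVec α := by ext i; simp; ring
  have h1 : (Matrix.of (fun (_ : Unit) b => -(B.mulVec α b / r)) * ⅟B *
      Matrix.of (fun a (_ : Unit) => -(B.mulVec α a / r))) () () =
      (fun i => B.mulVec α i / r) ⬝ᵥ B⁻¹.mulVec (fun i => B.mulVec α i / r) := by
    rw [Matrix.invOf_eq_nonsing_inv, Matrix.mul_assoc]
    simp [Matrix.mul_apply, Matrix.mulVec, dotProduct]
  rw [Matrix.det_unique]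
  change (1 : Matrix Unit Unit ℝ) () () - _ = _
  rw [h1, hδ, Matrix.mulVec_smul, Matrix.mulVec_mulVec,
    Matrix.nonsing_inv_mul _ hdet.ne'.isUnit, Matrix.one_mulVec, smul_dotProduct, dotProduct_smul,
    smul_eq_mul, smul_eq_mul, dotProduct_comm]
  have hQ : α ⬝ᵥ B.mulVec α = r ^ 2 - 1 := by linarith
  rw [hQ]; simp; field_simp; ring

lemma starM_quad {ι : Type*} [Fintype ι] [DecidableEq ι] (B : Matrix ι ι ℝ) (hB : B.PosDef)
    (α : ι → ℝ) (r : ℝ) (hr : 0 < r) (hrQ : r ^ 2 = 1 + α ⬝ᵥ B.mulVec α) (w : ι → ℝ)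
    (t : Unit → ℝ) :
    Sum.elim w t ⬝ᵥ (starM B (fun i => B.mulVec α i / r))⁻¹.mulVec (Sum.elim w t) =
      w ⬝ᵥ B⁻¹.mulVec w + (r * t () + α ⬝ᵥ w) ^ 2 := by
  have hdet := hB.det_pos
  have hδ : (fun i => B.mulVec α i / r) = r⁻¹ • B.mulVec α := by ext i; simp; ring
  have hs := (starM_posDef B hB α r hr hrQ).det_pos
  set β := r ^ 2 * (t () + r⁻¹ * (α ⬝ᵥ w)) with hβ
  have hp : (starM B (fun i => B.mulVec α i / r)).mulVec
      (Sum.elim (B⁻¹.mulVec w + (β / r) • α) (fun _ => β)) = Sum.elim w t := by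
    rw [starM_mulVec, hδ]
    ext i
    rcases i with i | i
    · simp only [Sum.elim_inl, Matrix.mulVec_add, Matrix.mulVec_smul, Matrix.mulVec_mulVec,
        Matrix.mul_nonsing_inv _ hdet.ne'.isUnit, Matrix.one_mulVec]
      simp; ring
    · simp only [Sum.elim_inr, dotProduct_add, smul_dotProduct, dotProduct_smul, smul_eq_mul]
      rw [dotProduct_comm _ α, dotProduct_comm _ (B⁻¹.mulVec w), symm_aux B hB _ α,
        Matrix.mulVec_mulVec, Matrix.mul_nonsing_inv _ hdet.ne'.isUnit, Matrix.one_mulVec]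
      have hQ : α ⬝ᵥ B.mulVec α = r ^ 2 - 1 := by linarith
      rw [hQ, hβ]; field_simp; ring
  nth_rewrite 2 [← hp]
  rw [Matrix.mulVec_mulVec, Matrix.nonsing_inv_mul _ hs.ne'.isUnit, Matrix.one_mulVec,
    sumElim_dotProduct_sumElim]
  have : t ⬝ᵥ (fun _ => β) = t () * β := by simp [dotProduct]
  rw [this, dotProduct_add, dotProduct_smul, smul_eq_mul, hβ, dotProduct_comm w α]
  field_simp; ring

lemma mvnPdf_star {ι : Type*} [Fintype ι] [DecidableEq ι] (B : Matrix ι ι ℝ) (hB : B.PosDef)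
    (α : ι → ℝ) (r : ℝ) (hr : 0 < r) (hrQ : r ^ 2 = 1 + α ⬝ᵥ B.mulVec α) (w : ι → ℝ)
    (t : Unit → ℝ) :
    mvnPdf (starM B (fun i => B.mulVec α i / r)) (Sum.elim w t) =
      mvnPdf B w * (r * nPdf (r * t () + α ⬝ᵥ w)) := by
  have hdet := hB.det_pos
  unfold mvnPdf nPdf
  rw [starM_quad B hB α r hr hrQ, starM_det B hB α r hr hrQ]
  have e1 : (2 * π) ^ (-(Fintype.card (ι ⊕ Unit) : ℝ) / 2) =
      (2 * π) ^ (-(Fintype.card ι : ℝ) / 2) * (Real.sqrt (2 * π))⁻¹ := by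
    rw [Real.sqrt_eq_rpow, ← Real.rpow_neg (by positivity), ← Real.rpow_add (by positivity)]
    congr 1; simp; ring
  have e2 : (B.det * (r ^ 2)⁻¹) ^ (-(1 : ℝ) / 2) = B.det ^ (-(1 : ℝ) / 2) * r := by
    rw [Real.mul_rpow hdet.le (by positivity)]
    congr 1
    rw [Real.inv_rpow (by positivity), neg_div, Real.rpow_neg (by positivity), inv_inv,
      ← Real.sqrt_eq_rpow, Real.sqrt_sq hr.le]
  have e3 : Real.exp (-(w ⬝ᵥ B⁻¹.mulVec w + (r * t () + α ⬝ᵥ w) ^ 2) / 2) =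
      Real.exp (-(w ⬝ᵥ B⁻¹.mulVec w) / 2) * Real.exp (-((r * t () + α ⬝ᵥ w) ^ 2) / 2) := by
    rw [← Real.exp_add]; congr 1; ring
  rw [e1, e2, e3]; ring

lemma nCdf_aux (r m T : ℝ) (hr : 0 < r) :
    ∫ t in Set.Iic (T / r), r * nPdf (r * t + m) = nCdf (m + T) := by
  have h := integral_add_right_eq_self (μ := volume) (Set.indicator (Set.Iic (m + T)) nPdf) m
  have h2 := Measure.integral_comp_mul_left
    (fun t => Set.indicator (Set.Iic (m + T)) nPdf (t + m)) r
  rw [h, smul_eq_mul, abs_of_pos (inv_pos.mpr hr)] at h2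
  unfold nCdf
  rw [← integral_Iic_eq_integral_Iio, integral_const_mul,
    ← integral_indicator (f := nPdf) measurableSet_Iic]
  rw [← integral_indicator (f := fun t => nPdf (r * t + m)) measurableSet_Iic]
  rw [eq_inv_mul_iff_mul_eq₀ hr.ne'] at h2
  rw [← h2]
  congr 2
  ext t
  simp only [Set.indicator, Set.mem_Iic]
  congr 1
  rw [le_div_iff₀ hr]
  apply propext; constructor <;> intro h <;> linarith

lemma mvnCdf_star {ι : Type*} [Fintype ι] [DecidableEq ι] (B : Matrix ι ι ℝ) (hB : B.PosDef)
    (α : ι → ℝ) (r : ℝ) (hr : 0 < r) (hrQ : r ^ 2 = 1 + α ⬝ᵥ B.mulVec α) (Y : ι → ℝ) (T : ℝ) :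
    mvnCdf (starM B (fun i => B.mulVec α i / r)) (Sum.elim Y fun _ => T / r) =
      ∫ w in Set.univ.pi fun i => Set.Iic (Y i), mvnPdf B w * nCdf (α ⬝ᵥ w + T) := by
  unfold mvnCdf
  have hmp := volume_measurePreserving_sumPiEquivProdPi_symm (fun _ : ι ⊕ Unit => ℝ)
  have hint := mvnPdf_integrable _ (starM_posDef B hB α r hr hrQ)
  have hint2 := (hmp.integrable_comp_emb (MeasurableEquiv.measurableEmbedding _)).2 hint
  rw [← hmp.setIntegral_preimage_emb (MeasurableEquiv.measurableEmbedding _)]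
  have hpre : (MeasurableEquiv.sumPiEquivProdPi (fun _ : ι ⊕ Unit => ℝ)).symm ⁻¹'
      (Set.univ.pi fun i => Set.Iic ((Sum.elim Y (fun _ => T / r) : ι ⊕ Unit → ℝ) i)) =
      (Set.univ.pi fun i => Set.Iic (Y i)) ×ˢ (Set.univ.pi fun _ : Unit => Set.Iic (T / r)) := by
    ext ⟨p1, p2⟩
    simp only [Set.mem_preimage, Set.mem_pi, Set.mem_univ, true_imp_iff, Set.mem_prod, Sum.forall]
    rfl
  rw [hpre]
  have hv : (volume : Measure ((ι → ℝ) × (Unit → ℝ))) = volume.prod volume := rfl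
  rw [hv] at hint2
  refine (setIntegral_prod _ hint2.integrableOn).trans ?_
  apply setIntegral_congr_fun (MeasurableSet.univ_pi fun i => measurableSet_Iic)
  intro w _
  have hs : ∀ t : Unit → ℝ, (MeasurableEquiv.sumPiEquivProdPi (fun _ : ι ⊕ Unit => ℝ)).symm (w, t) =
      Sum.elim w t := by
    intro t; ext i; rcases i <;> rfl
  simp only [Function.comp_apply, hs, mvnPdf_star B hB α r hr hrQ]
  rw [integral_const_mul]
  congr 1
  rw [← nCdf_aux r _ T hr]
  have hu := volume_preserving_funUnique Unit ℝ
  rw [← hu.setIntegral_preimage_emb (MeasurableEquiv.measurableEmbedding _)]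
  congr 1
  congr 1
  ext t
  simp only [Set.mem_pi, Set.mem_univ, true_imp_iff, Set.mem_Iic, Set.mem_preimage]
  exact ⟨fun h => h (), fun h _ => h⟩

lemma whiten_aux {ι : Type*} [Fintype ι] [DecidableEq ι] (S : Matrix ι ι ℝ) (hS : S.PosDef)
    (g : ι → ℝ) (hg : ∀ i, 0 < g i) :
    ((Matrix.diagonal g)⁻¹ = Matrix.diagonal fun i => (g i)⁻¹) ∧
    ((Matrix.diagonal g)⁻¹ * S * (Matrix.diagonal g)⁻¹).PosDef ∧
    (((Matrix.diagonal g)⁻¹ * S * (Matrix.diagonal g)⁻¹).det = S.det * ((∏ i, g i) ^ 2)⁻¹) ∧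
    ∀ x : ι → ℝ, (Matrix.diagonal g)⁻¹.mulVec x ⬝ᵥ
      ((Matrix.diagonal g)⁻¹ * S * (Matrix.diagonal g)⁻¹)⁻¹.mulVec
        ((Matrix.diagonal g)⁻¹.mulVec x) = x ⬝ᵥ S⁻¹.mulVec x := by
  have h1 : (Matrix.diagonal g)⁻¹ = Matrix.diagonal fun i => (g i)⁻¹ := by
    apply Matrix.inv_eq_right_inv
    rw [Matrix.diagonal_mul_diagonal, ← Matrix.diagonal_one]
    congr 1; ext i; exact mul_inv_cancel₀ (hg i).ne'
  have hd : (Matrix.diagonal g).det = ∏ i, g i := Matrix.det_diagonal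
  have hdp : 0 < (Matrix.diagonal g).det := by rw [hd]; exact Finset.prod_pos fun i _ => hg i
  have hu : IsUnit (Matrix.diagonal g).det := hdp.ne'.isUnit
  refine ⟨h1, ?_, ?_, ?_⟩
  · have := hS.conjTranspose_mul_mul_same (B := (Matrix.diagonal g)⁻¹)
      (Matrix.mulVec_injective_of_isUnit
        ((Matrix.isUnit_nonsing_inv_iff).2 ((Matrix.isUnit_iff_isUnit_det _).2 hu)))
    convert this using 2
    rw [h1]; simp
  · rw [Matrix.det_mul, Matrix.det_mul, Matrix.det_nonsing_inv, Ring.inverse_eq_inv', hd, sq,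
      mul_inv]
    ring
  · intro x
    rw [Matrix.mul_inv_rev, Matrix.mul_inv_rev, Matrix.nonsing_inv_nonsing_inv _ hu,
      Matrix.mulVec_mulVec, Matrix.mul_assoc, Matrix.mul_assoc, Matrix.mul_nonsing_inv _ hu,
      Matrix.mul_one, ← Matrix.mulVec_mulVec, Matrix.dotProduct_mulVec, ← Matrix.mulVec_transpose,
      Matrix.diagonal_transpose, Matrix.mulVec_mulVec, Matrix.mul_nonsing_inv _ hu,
      Matrix.one_mulVec]

lemma mvnPdf_whiten {ι : Type*} [Fintype ι] [DecidableEq ι] (S : Matrix ι ι ℝ) (hS : S.PosDef)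
    (g : ι → ℝ) (hg : ∀ i, 0 < g i) (x : ι → ℝ) :
    mvnPdf S x = (∏ i, g i)⁻¹ * mvnPdf ((Matrix.diagonal g)⁻¹ * S * (Matrix.diagonal g)⁻¹)
      ((Matrix.diagonal g)⁻¹.mulVec x) := by
  obtain ⟨-, -, h3, h4⟩ := whiten_aux S hS g hg
  have hP : 0 < ∏ i, g i := Finset.prod_pos fun i _ => hg i
  have hdet := hS.det_pos
  unfold mvnPdf
  rw [h3, h4]
  have e2 : (S.det * ((∏ i, g i) ^ 2)⁻¹) ^ (-(1 : ℝ) / 2) =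
      S.det ^ (-(1 : ℝ) / 2) * ∏ i, g i := by
    rw [Real.mul_rpow hdet.le (by positivity)]
    congr 1
    rw [Real.inv_rpow (by positivity), neg_div, Real.rpow_neg (by positivity), inv_inv,
      ← Real.sqrt_eq_rpow, Real.sqrt_sq hP.le]
  rw [e2]; field_simp

lemma step3 {ι : Type*} [Fintype ι] [DecidableEq ι] (S : Matrix ι ι ℝ) (hS : S.PosDef)
    (g : ι → ℝ) (hg : ∀ i, 0 < g i) (μ α y : ι → ℝ) (s T : ℝ) (hs : 0 < s) :
    ∫ u in Set.univ.pi fun i => Set.Iic (y i),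
      s ^ Fintype.card ι * mvnPdf S (fun i => s * (u i - μ i)) *
        nCdf (s * (α ⬝ᵥ (Matrix.diagonal g)⁻¹.mulVec fun i => u i - μ i) + T) =
    ∫ w in Set.univ.pi fun i => Set.Iic (s * (Matrix.diagonal g)⁻¹.mulVec (fun i => y i - μ i) i),
      mvnPdf ((Matrix.diagonal g)⁻¹ * S * (Matrix.diagonal g)⁻¹) w * nCdf (α ⬝ᵥ w + T) := by
  have hP : 0 < ∏ i, g i := Finset.prod_pos fun i _ => hg i
  obtain ⟨h1, -, -, -⟩ := whiten_aux S hS g hg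
  set W := (Matrix.diagonal g)⁻¹ with hW
  have hdetM : (s • W).det = s ^ Fintype.card ι * (∏ i, g i)⁻¹ := by
    rw [Matrix.det_smul, h1, Matrix.det_diagonal, Finset.prod_inv_distrib]
  have hMpos : 0 < (s • W).det := by rw [hdetM]; positivity
  rw [← integral_indicator (MeasurableSet.univ_pi fun i => measurableSet_Iic),
    ← integral_indicator (MeasurableSet.univ_pi fun i => measurableSet_Iic)]
  have hc := cov_aux (s • W) hMpos.ne' μ (Set.indicator
    (Set.univ.pi fun i => Set.Iic (s * W.mulVec (fun i => y i - μ i) i))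
    (fun w => mvnPdf (W * S * W) w * nCdf (α ⬝ᵥ w + T)))
  rw [abs_of_pos hMpos, eq_inv_mul_iff_mul_eq₀ hMpos.ne'] at hc
  rw [← hc, ← integral_const_mul]
  congr 1
  ext u
  have hmem : ((s • W).mulVec (fun i => u i - μ i) ∈
      Set.univ.pi fun i => Set.Iic (s * W.mulVec (fun i => y i - μ i) i)) ↔
      u ∈ Set.univ.pi fun i => Set.Iic (y i) := by
    simp only [Set.mem_pi, Set.mem_univ, true_imp_iff, Set.mem_Iic]
    apply forall_congr'
    intro i
    rw [Matrix.smul_mulVec, h1, Pi.smul_apply, smul_eq_mul, Matrix.mulVec_diagonal,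
      Matrix.mulVec_diagonal, mul_le_mul_iff_right₀ hs,
      mul_le_mul_iff_right₀ (inv_pos.mpr (hg i))]
    simp
  by_cases hu : u ∈ Set.univ.pi fun i => Set.Iic (y i)
  · rw [Set.indicator_of_mem hu, Set.indicator_of_mem (hmem.2 hu), hdetM,
      mvnPdf_whiten S hS g hg]
    have e : W.mulVec (fun i => s * (u i - μ i)) = (s • W).mulVec (fun i => u i - μ i) := by
      rw [Matrix.smul_mulVec, ← Matrix.mulVec_smul]; rfl
    rw [← hW, e, Matrix.smul_mulVec, dotProduct_smul, smul_eq_mul]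
    ring
  · rw [Set.indicator_of_notMem hu, Set.indicator_of_notMem (fun h => hu (hmem.1 h)), mul_zero]

lemma int_u_aux {ι : Type*} [Fintype ι] [DecidableEq ι] (S : Matrix ι ι ℝ) (hS : S.PosDef)
    (μ : ι → ℝ) (s : ℝ) (hs : 0 < s) (h : (ι → ℝ) → ℝ) (hm : Measurable h) :
    Integrable (fun u : ι → ℝ => mvnPdf S (fun i => s * (u i - μ i)) * nCdf (h u)) := by
  have h1 : Integrable (fun u : ι → ℝ => mvnPdf S (fun i => s * (u i - μ i))) :=
    ((mvnPdf_integrable S hS).comp_smul hs.ne').comp_sub_right μ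
  refine h1.mono' ?_ (ae_of_all _ fun u => ?_)
  · have := nCdf_meas
    exact h1.aestronglyMeasurable.mul (nCdf_meas.comp hm).aestronglyMeasurable
  · have h2 := mvnPdf_nonneg S hS (fun i => s * (u i - μ i))
    rw [Real.norm_of_nonneg (mul_nonneg h2 (nCdf_nonneg _))]
    exact mul_le_of_le_one_right h2 (nCdf_le_one _)

lemma main_aux {ι : Type*} [Fintype ι] [DecidableEq ι] (S : Matrix ι ι ℝ) (hS : S.PosDef)
    (g : ι → ℝ) (hg : ∀ i, 0 < g i) (μ α y : ι → ℝ) (τ κ ν r : ℝ) (hν : 0 < ν)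
    (B : Matrix ι ι ℝ) (hBdef : B = (Matrix.diagonal g)⁻¹ * S * (Matrix.diagonal g)⁻¹)
    (hr : 0 < r) (hrQ : r ^ 2 = 1 + α ⬝ᵥ B.mulVec α) :
    ∫ u in Set.univ.pi fun i => Set.Iic (y i),
      tPdf S ν (fun i => u i - μ i) *
        nctCdf ((α ⬝ᵥ ((Matrix.diagonal g)⁻¹.mulVec fun i => u i - μ i) + τ) *
          Real.sqrt ((ν + Fintype.card ι) / (ν +
            ((Matrix.diagonal g)⁻¹.mulVec fun i => u i - μ i) ⬝ᵥ B⁻¹.mulVec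
              ((Matrix.diagonal g)⁻¹.mulVec fun i => u i - μ i)))) κ (ν + Fintype.card ι) =
    mvnctCdf (Sum.elim ((Matrix.diagonal g)⁻¹.mulVec fun i => y i - μ i) fun _ => τ / r)
      (starM B (fun i => B.mulVec α i / r)) (Sum.elim 0 fun _ => κ / r) ν := by
  obtain ⟨h1, hB, h3, h4⟩ := whiten_aux S hS g hg
  rw [← hBdef] at hB h3 h4
  have hG2 : 0 < Real.Gamma (ν / 2) := Real.Gamma_pos_of_pos (by positivity)
  have hL : Measurable fun u : ι → ℝ => α ⬝ᵥ ((Matrix.diagonal g)⁻¹.mulVec fun i => u i - μ i) :=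
    Continuous.measurable (by fun_prop)
  simp_rw [h4, point_aux S hS _ _ κ ν hν]
  rw [swap_aux]
  · unfold mvnctCdf
    apply setIntegral_congr_fun measurableSet_Ioi
    intro v hv
    have hv : 0 < v := hv
    have hs : 0 < Real.sqrt (2 * v / ν) := by positivity
    simp only
    rw [integral_const_mul]
    congr 1
    have e := step3 S hS g hg μ α y (Real.sqrt (2 * v / ν)) (Real.sqrt (2 * v / ν) * τ - κ) hs
    rw [← hBdef, ← mvnCdf_star B hB α r hr hrQ] at e
    refine Eq.trans ?_ (e.trans ?_)
    · congr 1
      funext u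
      congr 2; ring
    · congr 1
      funext i
      rcases i with i | i
      · simp; ring
      · simp; ring
  · have := (mvnPdf_cont S).measurable
    have := nCdf_meas
    have hm : Measurable fun p : (ι → ℝ) × ℝ =>
        mvnPdf S (fun i => Real.sqrt (2 * p.2 / ν) * (p.1 i - μ i)) := by
      apply (mvnPdf_cont S).measurable.comp
      fun_prop
    have hL2 : Measurable fun p : (ι → ℝ) × ℝ =>
        α ⬝ᵥ ((Matrix.diagonal g)⁻¹.mulVec fun i => p.1 i - μ i) := hL.comp measurable_fst
    unfold Function.uncurry
    simp only
    fun_prop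
  · filter_upwards [ae_restrict_mem measurableSet_Ioi] with v hv u
    have hv : 0 < v := hv
    have hp := mvnPdf_nonneg S hS (fun i => Real.sqrt (2 * v / ν) * (u i - μ i))
    have hc0 := nCdf_nonneg ((α ⬝ᵥ ((Matrix.diagonal g)⁻¹.mulVec fun i => u i - μ i) + τ) *
      Real.sqrt (2 * v / ν) - κ)
    positivity
  · exact ae_of_all _ fun u => int_v_aux S hS (fun i => u i - μ i) _ κ ν hν
  · filter_upwards [ae_restrict_mem measurableSet_Ioi] with v hv
    have hv : 0 < v := hv
    have hs : 0 < Real.sqrt (2 * v / ν) := by positivity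
    apply Integrable.const_mul
    simp_rw [mul_assoc]
    apply Integrable.const_mul
    exact (int_u_aux S hS μ _ hs _ (by fun_prop)).integrableOn


/-- the distribution function of the non-central extended skew-t distribution
as a ratio of non-central t distribution functions. -/
theorem skewT_cdf_ratio
    (d : ℕ) (μ : Fin d → ℝ) (Ω : Matrix (Fin d) (Fin d) ℝ) (hΩ : Ω.PosDef)
    (α : Fin d → ℝ) (τ κ ν : ℝ) (hν : 0 < ν) :
    let ω : Matrix (Fin d) (Fin d) ℝ := Matrix.diagonal fun i => Real.sqrt (Ω i i)
    let Ωb : Matrix (Fin d) (Fin d) ℝ := ω⁻¹ * Ω * ω⁻¹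
    let Q : ℝ := α ⬝ᵥ Ωb.mulVec α
    let δ : Fin d → ℝ := fun i => Ωb.mulVec α i / Real.sqrt (1 + Q)
    let κb : ℝ := κ / Real.sqrt (1 + Q)
    let τb : ℝ := τ / Real.sqrt (1 + Q)
    let Ωstar : Matrix (Fin d ⊕ Unit) (Fin d ⊕ Unit) ℝ := fun i j =>
      match i, j with
      | Sum.inl a, Sum.inl b => Ωb a b
      | Sum.inl a, Sum.inr _ => -δ a
      | Sum.inr _, Sum.inl b => -δ b
      | Sum.inr _, Sum.inr _ => 1
    Ωstar.PosDef ∧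
    ∀ y : Fin d → ℝ,
      skewTCdf μ Ω α τ κ ν y =
        mvnctCdf (Sum.elim (ω⁻¹.mulVec fun i => y i - μ i) fun _ => τb) Ωstar
            (Sum.elim 0 fun _ => κb) ν /
          nctCdf τb κb ν := by
  intro ω Ωb Q δ κb τb Ωstar
  have hg : ∀ i, 0 < Real.sqrt (Ω i i) := fun i => Real.sqrt_pos.mpr hΩ.diag_pos
  have hB : Ωb.PosDef := (whiten_aux Ω hΩ _ hg).2.1
  have hQ : 0 ≤ Q := by simpa using hB.posSemidef.dotProduct_mulVec_nonneg α
  have hr : 0 < Real.sqrt (1 + Q) := by positivity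
  have hrQ : Real.sqrt (1 + Q) ^ 2 = 1 + α ⬝ᵥ Ωb.mulVec α := Real.sq_sqrt (by positivity)
  have hstar : Ωstar = starM Ωb (fun i => Ωb.mulVec α i / Real.sqrt (1 + Q)) := by
    ext i j
    rcases i with i | i <;> rcases j with j | j <;> rfl
  rw [hstar]
  refine ⟨starM_posDef Ωb hB α _ hr hrQ, fun y => ?_⟩
  rw [← main_aux Ω hΩ _ hg μ α y τ κ ν _ hν Ωb rfl hr hrQ, ← integral_div]
  rfl
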